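/- Under assumptions (A1)–(A3), let K be a compact subset of M_1(Z) such that any two points of K are equivalent (ν ∼ ξ, i.e. V(ξ|ν) = V(ν|ξ) = 0) but no point of K is equivalent to any point of M_1(Z) outside K. Then for any ε > 0, δ > 0 and ν, ξ ∈ K, there exist T > 0 and an absolutely continuous path μ : [0,T] → M_1(Z) with μ(0) = ν, μ(T) = ξ, μ(t) in the open δ-neighborhood of K for all t ∈ [0,T], and S_{[0,T]}(μ|ν) < ε. -/

import Mathlib

open MeasureTheory Set ENNReal Filter

noncomputable section

/-- The Legendre conjugate `τ*(u) = (u+1)·log(u+1) − u`.  Since `Real.log 0 = 0`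
in Mathlib, this gives `τ*(-1) = 1`, matching the convention of the paper; the
value for `u < -1` is irrelevant since all arguments below are `≥ -1`. -/
def tauStar (u : ℝ) : ℝ := (u + 1) * Real.log (u + 1) - u

/-- The mean field model: state space `Fin r`, directed edge set `E` without
self-loops, and transition rate functions `lam i j`, together with assumptions
(A1) (irreducibility), (A2) (Lipschitz rates) and (A3) (rates on edges bounded
below by `c > 0`); `Cb` is the upper bound on the rates (a consequence of
(A2) and compactness of the simplex). -/
structure MeanFieldModel (r : ℕ) where
  E : Finset (Fin r × Fin r)
  no_diag : ∀ i : Fin r, (i, i) ∉ E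
  /-- (A1): the directed graph `(Z, E)` is irreducible. -/
  irreducible : ∀ i j : Fin r, Relation.ReflTransGen (fun a b => (a, b) ∈ E) i j
  lam : Fin r → Fin r → (Fin r → ℝ) → ℝ
  /-- (A2): each rate function is Lipschitz on the simplex. -/
  lam_lipschitz : ∀ p ∈ E, ∃ K : NNReal, LipschitzOnWith K (lam p.1 p.2) (stdSimplex ℝ (Fin r))
  c : ℝ
  c_pos : 0 < c
  /-- (A3): rates of admissible jumps are uniformly bounded away from zero. -/
  lam_lower : ∀ p ∈ E, ∀ μ ∈ stdSimplex ℝ (Fin r), c ≤ lam p.1 p.2 μ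
  /-- rates vanish off the edge set -/
  lam_off : ∀ i j : Fin r, i ≠ j → (i, j) ∉ E → ∀ μ : Fin r → ℝ, lam i j μ = 0
  /-- diagonal convention `λ_{i,i} = −Σ_{j≠i} λ_{i,j}` -/
  lam_diag : ∀ i : Fin r, ∀ μ : Fin r → ℝ,
    lam i i μ = -∑ j ∈ Finset.univ.filter (fun j => j ≠ i), lam i j μ
  Cb : ℝ
  /-- upper bound on the rates -/
  lam_upper : ∀ p ∈ E, ∀ μ ∈ stdSimplex ℝ (Fin r), lam p.1 p.2 μ ≤ Cb

variable {r : ℕ}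

/-- A time-varying rate matrix `L(t)` adapted to the model: measurable entries,
nonnegative off-diagonal entries, entries vanishing off the edge set, and the
diagonal convention `l_{i,i}(t) = −Σ_{j≠i} l_{i,j}(t)`. -/
def IsRateMatrix (M : MeanFieldModel r) (L : ℝ → Fin r → Fin r → ℝ) : Prop :=
  (∀ i j : Fin r, Measurable fun t => L t i j) ∧
  (∀ t : ℝ, ∀ i j : Fin r, i ≠ j → 0 ≤ L t i j) ∧
  (∀ t : ℝ, ∀ i j : Fin r, i ≠ j → (i, j) ∉ M.E → L t i j = 0) ∧
  (∀ t : ℝ, ∀ i : Fin r,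
    L t i i = -∑ j ∈ Finset.univ.filter (fun j => j ≠ i), L t i j)

/-- `μ` is absolutely continuous on `[0,T]` with `μ̇(t) = L(t)ᵀ μ(t)` a.e.,
expressed in integral form:  `μ(t) = μ(0) + ∫_0^t L(s)ᵀ μ(s) ds`. -/
def SolvesODE (L : ℝ → Fin r → Fin r → ℝ) (μ : ℝ → Fin r → ℝ) (T : ℝ) : Prop :=
  (∀ i : Fin r, IntegrableOn (fun t => ∑ j, L t j i * μ t j) (Icc 0 T)) ∧
  ∀ t ∈ Icc (0 : ℝ) T, ∀ i : Fin r,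
    μ t i = μ 0 i + ∫ s in Ioc (0 : ℝ) t, ∑ j, L s j i * μ s j

/-- `μ` is absolutely continuous on `[0,∞)` with `μ̇(t) = −L(t)ᵀ μ(t)` a.e.
(reversed-time dynamics), in integral form. -/
def SolvesReversedODE (L : ℝ → Fin r → Fin r → ℝ) (μ : ℝ → Fin r → ℝ) : Prop :=
  (∀ T : ℝ, 0 < T → ∀ i : Fin r,
    IntegrableOn (fun t => ∑ j, L t j i * μ t j) (Icc 0 T)) ∧
  ∀ t : ℝ, 0 ≤ t → ∀ i : Fin r,
    μ t i = μ 0 i - ∫ s in Ioc (0 : ℝ) t, ∑ j, L s j i * μ s j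

/-- The running cost
`I_{[0,T]}(μ, L) = ∫_0^T Σ_{(i,j)∈E} μ(t)(i) λ_{i,j}(μ(t)) τ*( l_{i,j}(t)/λ_{i,j}(μ(t)) − 1 ) dt`. -/
def runningCost (M : MeanFieldModel r) (μ : ℝ → Fin r → ℝ)
    (L : ℝ → Fin r → Fin r → ℝ) (T : ℝ) : ℝ≥0∞ :=
  ∫⁻ t in Ioc (0 : ℝ) T, ENNReal.ofReal (∑ p ∈ M.E,
    μ t p.1 * M.lam p.1 p.2 (μ t) * tauStar (L t p.1 p.2 / M.lam p.1 p.2 (μ t) - 1))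

/-- The infinite-horizon running cost on `[0, ∞)`. -/
def runningCostInf (M : MeanFieldModel r) (μ : ℝ → Fin r → ℝ)
    (L : ℝ → Fin r → Fin r → ℝ) : ℝ≥0∞ :=
  ∫⁻ t in Ioi (0 : ℝ), ENNReal.ofReal (∑ p ∈ M.E,
    μ t p.1 * M.lam p.1 p.2 (μ t) * tauStar (L t p.1 p.2 / M.lam p.1 p.2 (μ t) - 1))

/-- `S_{[0,T]}(μ | ν)`: the infimum of the running cost over all time-varying
rate matrices `L` with `μ̇ = Lᵀ μ` a.e., provided `μ(0) = ν`, `μ` is absolutely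
continuous and takes values in `M₁(Z)`; `+∞` otherwise (the infimum over an
empty family being `⊤`). -/
def SPath (M : MeanFieldModel r) (T : ℝ) (ν : Fin r → ℝ) (μ : ℝ → Fin r → ℝ) : ℝ≥0∞ :=
  ⨅ (L : ℝ → Fin r → Fin r → ℝ)
    (_ : IsRateMatrix M L ∧ SolvesODE L μ T ∧ μ 0 = ν ∧
      ∀ t ∈ Icc (0 : ℝ) T, μ t ∈ stdSimplex ℝ (Fin r)),
    runningCost M μ L T

/-- `S_T(ξ | ν) = inf { S_{[0,T]}(μ|ν) : μ(0) = ν, μ(T) = ξ }`. -/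
def SEnd (M : MeanFieldModel r) (T : ℝ) (ν ξ : Fin r → ℝ) : ℝ≥0∞ :=
  ⨅ (μ : ℝ → Fin r → ℝ) (_ : μ 0 = ν ∧ μ T = ξ), SPath M T ν μ

/-- The quasipotential `V(ξ | ν) = inf_{T > 0} S_T(ξ | ν)`. -/
def quasipotential (M : MeanFieldModel r) (ν ξ : Fin r → ℝ) : ℝ≥0∞ :=
  ⨅ (T : ℝ) (_ : 0 < T), SEnd M T ν ξ

/-- Equivalence of points: `ν ∼ ξ` iff `V(ξ|ν) = V(ν|ξ) = 0`. -/
def VEquiv (M : MeanFieldModel r) (ν ξ : Fin r → ℝ) : Prop :=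
  quasipotential M ν ξ = 0 ∧ quasipotential M ξ ν = 0

/-- `s` satisfies the dynamic programming equation
`s(ξ) = inf_{ν ∈ M₁(Z)} [ s(ν) + S_T(ξ|ν) ]` for every `T > 0`. -/
def SatisfiesDPE (M : MeanFieldModel r) (s : (Fin r → ℝ) → ℝ) : Prop :=
  ∀ T : ℝ, 0 < T → ∀ ξ ∈ stdSimplex ℝ (Fin r),
    ENNReal.ofReal (s ξ) =
      ⨅ ν ∈ stdSimplex ℝ (Fin r), (ENNReal.ofReal (s ν) + SEnd M T ν ξ)

/-- A solution of the McKean–Vlasov equation `μ̇(t) = A_{μ(t)}ᵀ μ(t)` on `[0,∞)`,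
as a path in `M₁(Z)`, in integral form. -/
def IsMVSolution (M : MeanFieldModel r) (η : ℝ → Fin r → ℝ) : Prop :=
  (∀ t : ℝ, 0 ≤ t → η t ∈ stdSimplex ℝ (Fin r)) ∧
  (∀ T : ℝ, 0 < T → ∀ i : Fin r,
    IntegrableOn (fun t => ∑ j, M.lam j i (η t) * η t j) (Icc 0 T)) ∧
  ∀ t : ℝ, 0 ≤ t → ∀ i : Fin r,
    η t i = η 0 i + ∫ s in Ioc (0 : ℝ) t, ∑ j, M.lam j i (η s) * η s j

/-- A solution of the time-reversed McKean–Vlasov equation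
`η̇(t) = −A_{η(t)}ᵀ η(t)` on `[0,∞)`, in integral form. -/
def IsReversedMVSolution (M : MeanFieldModel r) (η : ℝ → Fin r → ℝ) : Prop :=
  (∀ T : ℝ, 0 < T → ∀ i : Fin r,
    IntegrableOn (fun t => ∑ j, M.lam j i (η t) * η t j) (Icc 0 T)) ∧
  ∀ t : ℝ, 0 ≤ t → ∀ i : Fin r,
    η t i = η 0 i - ∫ s in Ioc (0 : ℝ) t, ∑ j, M.lam j i (η s) * η s j

/-- `ξ₀` is the unique globally asymptotically stable equilibrium of the
McKean–Vlasov equation: `A_{ξ₀}ᵀ ξ₀ = 0` and every solution with initial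
condition in `M₁(Z)` converges to `ξ₀`. -/
def IsUniqueGASEquilibrium (M : MeanFieldModel r) (ξ₀ : Fin r → ℝ) : Prop :=
  ξ₀ ∈ stdSimplex ℝ (Fin r) ∧
  (∀ i : Fin r, ∑ j, M.lam j i ξ₀ * ξ₀ j = 0) ∧
  ∀ η : ℝ → Fin r → ℝ, IsMVSolution M η → Tendsto η atTop (nhds ξ₀)

/-- The ω-limit set of a path: `Ω = ∩_{t>0} closure { μ(t') : t' ≥ t }`. -/
def omegaSet (η : ℝ → Fin r → ℝ) : Set (Fin r → ℝ) :=
  ⋂ t ∈ Ioi (0 : ℝ), closure (η '' Ici t)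

/-- Assumption (B): finitely many compact subsets `K 1, …, K l` of `M₁(Z)` such
that any two points of the same `K i` are equivalent, no point of `K i` is
equivalent to a point of `M₁(Z)` outside `K i`, and every ω-limit set of the
McKean–Vlasov equation is contained in some `K i`. -/
def AssumptionB (M : MeanFieldModel r) (l : ℕ) (K : Fin l → Set (Fin r → ℝ)) : Prop :=
  (∀ i, IsCompact (K i)) ∧
  (∀ i, K i ⊆ stdSimplex ℝ (Fin r)) ∧
  (∀ i, ∀ ν ∈ K i, ∀ ξ ∈ K i, VEquiv M ν ξ) ∧
  (∀ i, ∀ ν ∈ K i, ∀ ξ ∈ stdSimplex ℝ (Fin r), ξ ∉ K i → ¬ VEquiv M ν ξ) ∧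
  (∀ η : ℝ → Fin r → ℝ, IsMVSolution M η → ∃ i, omegaSet η ⊆ K i)

/-- `μ` is continuous and piecewise linear on `[0,T]`, with constant velocity on
each linear segment (linear interpolation between the breakpoints). -/
def PiecewiseLinear (μ : ℝ → Fin r → ℝ) (T : ℝ) : Prop :=
  ∃ (n : ℕ) (t : Fin (n + 1) → ℝ), StrictMono t ∧ t 0 = 0 ∧ t (Fin.last n) = T ∧
    ∀ k : Fin n, ∀ u ∈ Icc (t k.castSucc) (t k.succ), ∀ i : Fin r,
      μ u i = μ (t k.castSucc) i +
        (u - t k.castSucc) / (t k.succ - t k.castSucc) *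
          (μ (t k.succ) i - μ (t k.castSucc) i)

end

section Helpers

def Conn {r : ℕ} (M : MeanFieldModel r) (T : ℝ) (μ : ℝ → Fin r → ℝ)
    (L : ℝ → Fin r → Fin r → ℝ) (x y : Fin r → ℝ) : Prop :=
  IsRateMatrix M L ∧ SolvesODE L μ T ∧ μ 0 = x ∧ μ T = y ∧
    ∀ t ∈ Icc (0 : ℝ) T, μ t ∈ stdSimplex ℝ (Fin r)

def Reach {r : ℕ} (M : MeanFieldModel r) (x y : Fin r → ℝ) (a : ℝ≥0∞) : Prop :=
  ∃ (T : ℝ) (μ : ℝ → Fin r → ℝ) (L : ℝ → Fin r → Fin r → ℝ),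
    0 < T ∧ Conn M T μ L x y ∧ runningCost M μ L T < a

lemma quasi_lt_iff {r : ℕ} (M : MeanFieldModel r) (x y : Fin r → ℝ) (a : ℝ≥0∞) :
    quasipotential M x y < a ↔ Reach M x y a := by
  simp only [quasipotential, SEnd, SPath, iInf_lt_iff, Reach, Conn]
  constructor
  · rintro ⟨T, hT, μ, ⟨h0, h1⟩, L, ⟨hL, hS, h2, h3⟩, hc⟩
    exact ⟨T, μ, L, hT, ⟨hL, hS, h0, h1, h3⟩, hc⟩
  · rintro ⟨T, μ, L, hT, ⟨hL, hS, h0, h1, h3⟩, hc⟩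
    exact ⟨T, hT, μ, ⟨h0, h1⟩, L, ⟨hL, hS, h0, h3⟩, hc⟩

lemma quasi_zero_iff {r : ℕ} (M : MeanFieldModel r) (x y : Fin r → ℝ) :
    quasipotential M x y = 0 ↔ ∀ a : ℝ≥0∞, a ≠ 0 → Reach M x y a := by
  constructor
  · intro h a ha
    rw [← quasi_lt_iff, h]
    exact pos_iff_ne_zero.mpr ha
  · intro h
    by_contra hne
    have := (quasi_lt_iff M x y _).mpr (h _ hne)
    exact lt_irrefl _ this

lemma Reach.mono {r : ℕ} {M : MeanFieldModel r} {x y : Fin r → ℝ} {a b : ℝ≥0∞}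
    (h : Reach M x y a) (hab : a ≤ b) : Reach M x y b := by
  obtain ⟨T, μ, L, hT, hC, hc⟩ := h
  exact ⟨T, μ, L, hT, hC, hc.trans_le hab⟩

lemma Reach.right_mem {r : ℕ} {M : MeanFieldModel r} {x y : Fin r → ℝ} {a : ℝ≥0∞}
    (h : Reach M x y a) : y ∈ stdSimplex ℝ (Fin r) := by
  obtain ⟨T, μ, L, hT, ⟨_, _, _, h1, h3⟩, hc⟩ := h
  rw [← h1]
  exact h3 T ⟨hT.le, le_rfl⟩

lemma setLInt_shift (f : ℝ → ℝ≥0∞) (a b : ℝ) :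
    ∫⁻ t in Ioc a (a + b), f (t - a) = ∫⁻ t in Ioc 0 b, f t := by
  have h := (measurePreserving_sub_right (volume : Measure ℝ) a).setLIntegral_comp_preimage_emb
    (MeasurableEquiv.subRight a).measurableEmbedding f (Ioc 0 b)
  rw [← h]
  congr 2
  ext t
  simp only [mem_preimage, mem_Ioc]
  constructor <;> rintro ⟨h1, h2⟩ <;> constructor <;> linarith

lemma setLInt_reflect (f : ℝ → ℝ≥0∞) (m : ℝ) :
    ∫⁻ t in Ioo 0 m, f (m - t) = ∫⁻ t in Ioo 0 m, f t := by
  have h := (Measure.measurePreserving_sub_left (volume : Measure ℝ) m).setLIntegral_comp_preimage_emb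
    (MeasurableEquiv.subLeft m).measurableEmbedding f (Ioo 0 m)
  rw [← h]
  congr 2
  ext t
  simp only [mem_preimage, mem_Ioo]
  constructor <;> rintro ⟨h1, h2⟩ <;> constructor <;> linarith

lemma Conn.restrict {r : ℕ} {M : MeanFieldModel r} {T : ℝ} {μ : ℝ → Fin r → ℝ}
    {L : ℝ → Fin r → Fin r → ℝ} {x y : Fin r → ℝ} (h : Conn M T μ L x y)
    {s : ℝ} (hs : s ∈ Icc 0 T) : Conn M s μ L x (μ s) := by
  obtain ⟨hL, hS, h0, h1, h3⟩ := h
  refine ⟨hL, ⟨fun i => (hS.1 i).mono_set (Icc_subset_Icc le_rfl hs.2), fun t ht i => ?_⟩,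
    h0, rfl, fun t ht => h3 t ⟨ht.1, ht.2.trans hs.2⟩⟩
  exact hS.2 t ⟨ht.1, ht.2.trans hs.2⟩ i

lemma Conn.shift {r : ℕ} {M : MeanFieldModel r} {T : ℝ} {μ : ℝ → Fin r → ℝ}
    {L : ℝ → Fin r → Fin r → ℝ} {x y : Fin r → ℝ} (h : Conn M T μ L x y)
    {s : ℝ} (hs : s ∈ Icc 0 T) :
    Conn M (T - s) (fun t => μ (t + s)) (fun t => L (t + s)) (μ s) y := by
  obtain ⟨hL, hS, h0, h1, h3⟩ := h
  have hs0 := hs.1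
  have hsT := hs.2
  refine ⟨⟨fun i j => (hL.1 i j).comp (measurable_id.add_const s), fun t => hL.2.1 _,
    fun t => hL.2.2.1 _, fun t => hL.2.2.2 _⟩, ⟨fun i => ?_, fun t ht i => ?_⟩, by simp, by simpa,
    fun t ht => h3 _ ⟨by linarith [ht.1], by linarith [ht.2]⟩⟩
  · have h1 : IntervalIntegrable (fun t => ∑ j, L t j i * μ t j) volume s T := by
      rw [intervalIntegrable_iff_integrableOn_Icc_of_le hsT]
      exact (hS.1 i).mono_set (Icc_subset_Icc hs0 le_rfl)
    have h2 := h1.comp_add_right s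
    rw [sub_self, intervalIntegrable_iff_integrableOn_Icc_of_le (by linarith)] at h2
    exact h2
  · have ht0 := ht.1
    have ht1 := ht.2
    have e1 := hS.2 s hs i
    have e2 := hS.2 (t + s) ⟨by linarith, by linarith⟩ i
    have hi : ∀ u v, 0 ≤ u → u ≤ v → v ≤ T →
        IntervalIntegrable (fun t => ∑ j, L t j i * μ t j) volume u v := by
      intro u v hu huv hv
      rw [intervalIntegrable_iff_integrableOn_Icc_of_le huv]
      exact (hS.1 i).mono_set (Icc_subset_Icc hu hv)
    rw [← intervalIntegral.integral_of_le (by linarith)] at e1 e2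
    rw [← intervalIntegral.integral_of_le ht0]
    have e3 := intervalIntegral.integral_comp_add_right (a := 0) (b := t)
      (fun t => ∑ j, L t j i * μ t j) s
    have e4 := intervalIntegral.integral_add_adjacent_intervals
      (hi 0 s le_rfl hs0 hsT) (hi s (t + s) hs0 (by linarith) (by linarith))
    rw [zero_add] at e3
    simp only [zero_add]
    rw [e3]
    linarith

lemma cost_split {r : ℕ} (M : MeanFieldModel r) (μ : ℝ → Fin r → ℝ)
    (L : ℝ → Fin r → Fin r → ℝ) {s T : ℝ} (hs : 0 ≤ s) (hT : s ≤ T) :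
    runningCost M μ L T = runningCost M μ L s +
      runningCost M (fun t => μ (t + s)) (fun t => L (t + s)) (T - s) := by
  unfold runningCost
  rw [← Ioc_union_Ioc_eq_Ioc hs hT, lintegral_union measurableSet_Ioc
    (Set.disjoint_left.mpr fun t h1 h2 => absurd h1.2 (not_le.mpr h2.1))]
  congr 1
  rw [← setLInt_shift _ s (T - s)]
  simp

lemma Reach.trans {r : ℕ} {M : MeanFieldModel r} {x y z : Fin r → ℝ} {a b : ℝ≥0∞}
    (h1 : Reach M x y a) (h2 : Reach M y z b) : Reach M x z (a + b) := by
  obtain ⟨T, μ, L, hT, ⟨hL, hS, h0, h1, h3⟩, hc⟩ := h1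
  obtain ⟨T', μ', L', hT', ⟨hL', hS', h0', h1', h3'⟩, hc'⟩ := h2
  set μ'' : ℝ → Fin r → ℝ := fun t => if t ≤ T then μ t else μ' (t - T) with hμ''
  set L'' : ℝ → Fin r → Fin r → ℝ := fun t => if t ≤ T then L t else L' (t - T) with hL''
  have m1 : ∀ t, t ≤ T → μ'' t = μ t := fun t ht => by simp [hμ'', ht]
  have l1 : ∀ t, t ≤ T → L'' t = L t := fun t ht => by simp [hL'', ht]
  have m2 : ∀ t, T < t → μ'' t = μ' (t - T) := fun t ht => by simp [hμ'', not_le.mpr ht]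
  have l2 : ∀ t, T < t → L'' t = L' (t - T) := fun t ht => by simp [hL'', not_le.mpr ht]
  have hint2 : ∀ i, ∀ t ∈ Icc 0 T', IntervalIntegrable (fun t => ∑ j, L'' t j i * μ'' t j)
      volume T (T + t) ∧ ∫ s in T..(T + t), (∑ j, L'' s j i * μ'' s j) =
        ∫ s in (0:ℝ)..t, ∑ j, L' s j i * μ' s j := by
    intro i t ht
    have hi : IntervalIntegrable (fun t => ∑ j, L' t j i * μ' t j) volume 0 t := by
      rw [intervalIntegrable_iff_integrableOn_Icc_of_le ht.1]
      exact (hS'.1 i).mono_set (Icc_subset_Icc le_rfl ht.2)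
    have hi2 := hi.comp_sub_right T
    rw [zero_add, add_comm t T] at hi2
    have e := intervalIntegral.integral_comp_sub_right (a := T) (b := T + t)
      (fun t => ∑ j, L' t j i * μ' t j) T
    rw [sub_self, add_sub_cancel_left] at e
    have hc : EqOn (fun t => ∑ j, L' (t - T) j i * μ' (t - T) j)
        (fun t => ∑ j, L'' t j i * μ'' t j) (Ioc T (T + t)) := by
      intro s hs
      simp only [m2 s hs.1, l2 s hs.1]
    have hle : T ≤ T + t := by linarith [ht.1]
    constructor
    · rw [intervalIntegrable_iff_integrableOn_Ioc_of_le hle] at hi2 ⊢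
      exact hi2.congr_fun hc measurableSet_Ioc
    · rw [← e, intervalIntegral.integral_of_le hle, intervalIntegral.integral_of_le hle]
      exact (setIntegral_congr_fun measurableSet_Ioc hc).symm
  have hint1 : ∀ i, ∀ t ∈ Icc 0 T, IntervalIntegrable (fun t => ∑ j, L'' t j i * μ'' t j)
      volume 0 t ∧ ∫ s in (0:ℝ)..t, (∑ j, L'' s j i * μ'' s j) =
        ∫ s in (0:ℝ)..t, ∑ j, L s j i * μ s j := by
    intro i t ht
    have hi : IntervalIntegrable (fun t => ∑ j, L t j i * μ t j) volume 0 t := by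
      rw [intervalIntegrable_iff_integrableOn_Icc_of_le ht.1]
      exact (hS.1 i).mono_set (Icc_subset_Icc le_rfl ht.2)
    have hc : EqOn (fun t => ∑ j, L t j i * μ t j)
        (fun t => ∑ j, L'' t j i * μ'' t j) (Ioc 0 t) := by
      intro s hs
      simp only [m1 s (hs.2.trans ht.2), l1 s (hs.2.trans ht.2)]
    constructor
    · rw [intervalIntegrable_iff_integrableOn_Ioc_of_le ht.1] at hi ⊢
      exact hi.congr_fun hc measurableSet_Ioc
    · rw [intervalIntegral.integral_of_le ht.1, intervalIntegral.integral_of_le ht.1]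
      exact (setIntegral_congr_fun measurableSet_Ioc hc).symm
  refine ⟨T + T', μ'', L'', by linarith, ⟨⟨?_, ?_, ?_, ?_⟩, ⟨?_, ?_⟩, ?_, ?_, ?_⟩, ?_⟩
  · intro i j
    have : (fun t => L'' t i j) = fun t => if t ≤ T then L t i j else L' (t - T) i j := by
      funext t
      simp only [hL'']
      split_ifs <;> rfl
    rw [this]
    exact Measurable.ite measurableSet_Iic (hL.1 i j)
      ((hL'.1 i j).comp (measurable_id.sub_const T))
  · intro t i j hij
    by_cases ht : t ≤ T
    · rw [l1 t ht]; exact hL.2.1 t i j hij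
    · rw [l2 t (not_le.mp ht)]; exact hL'.2.1 _ i j hij
  · intro t i j hij
    by_cases ht : t ≤ T
    · rw [l1 t ht]; exact hL.2.2.1 t i j hij
    · rw [l2 t (not_le.mp ht)]; exact hL'.2.2.1 _ i j hij
  · intro t i
    by_cases ht : t ≤ T
    · rw [l1 t ht]; exact hL.2.2.2 t i
    · rw [l2 t (not_le.mp ht)]; exact hL'.2.2.2 _ i
  · intro i
    rw [← intervalIntegrable_iff_integrableOn_Icc_of_le (by linarith)]
    exact (hint1 i T ⟨hT.le, le_rfl⟩).1.trans (hint2 i T' ⟨hT'.le, le_rfl⟩).1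
  · intro t ht i
    rw [← intervalIntegral.integral_of_le ht.1, m1 0 hT.le]
    by_cases htT : t ≤ T
    · rw [m1 t htT, (hint1 i t ⟨ht.1, htT⟩).2, intervalIntegral.integral_of_le ht.1]
      exact hS.2 t ⟨ht.1, htT⟩ i
    · have htT' := not_le.mp htT
      have hm : t - T ∈ Icc 0 T' := ⟨by linarith, by linarith [ht.2]⟩
      have k1 := hint1 i T ⟨hT.le, le_rfl⟩
      have k2 := hint2 i (t - T) hm
      have e1 := hS.2 T ⟨hT.le, le_rfl⟩ i
      have e2 := hS'.2 (t - T) hm i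
      rw [← intervalIntegral.integral_of_le hm.1] at e2
      rw [← intervalIntegral.integral_of_le hT.le] at e1
      rw [add_sub_cancel] at k2
      rw [← intervalIntegral.integral_add_adjacent_intervals k1.1 k2.1, k1.2, k2.2, m2 t htT', e2,
        h0', ← h1, e1, add_assoc]
  · rw [m1 0 hT.le, h0]
  · rw [m2 _ (by linarith), add_sub_cancel_left, h1']
  · intro t ht
    by_cases htT : t ≤ T
    · rw [m1 t htT]; exact h3 t ⟨ht.1, htT⟩
    · rw [m2 t (not_le.mp htT)]
      exact h3' _ ⟨by linarith, by linarith [ht.2]⟩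
  · refine lt_of_le_of_lt (le_of_eq ?_) (ENNReal.add_lt_add hc hc')
    rw [cost_split M μ'' L'' hT.le (by linarith : T ≤ T + T'), add_sub_cancel_left]
    unfold runningCost
    congr 1
    · refine setLIntegral_congr_fun measurableSet_Ioc fun t ht => ?_
      simp only [m1 t ht.2, l1 t ht.2]
    · refine setLIntegral_congr_fun measurableSet_Ioc fun t ht => ?_
      have : T < t + T := by linarith [ht.1]
      simp only [m2 _ this, l2 _ this, add_sub_cancel_right]

lemma cost_small {r : ℕ} (M : MeanFieldModel r) {a : ℝ≥0∞} (ha : a ≠ 0) :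
    ∀ᶠ m in nhdsWithin (0:ℝ) (Ioi 0), ∀ (μ : ℝ → Fin r → ℝ) (L : ℝ → Fin r → Fin r → ℝ),
      (∀ t ∈ Ioo 0 m, ∀ p ∈ M.E, μ t p.1 * M.lam p.1 p.2 (μ t) *
        tauStar (L t p.1 p.2 / M.lam p.1 p.2 (μ t) - 1) ≤
          M.Cb + |Real.log M.c| + |Real.log (m - t)|) →
      runningCost M μ L m < a := by
  set g : ℝ → ℝ := fun s => (M.E.card : ℝ) * (M.Cb + |Real.log M.c| + |Real.log s|) with hg
  have hgi : IntegrableOn g (Ioc 0 1) := by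
    have h1 : IntervalIntegrable Real.log volume 0 1 := intervalIntegral.intervalIntegrable_log'
    have h2 := ((intervalIntegrable_const (c := M.Cb + |Real.log M.c|)).add h1.abs).const_mul (M.E.card : ℝ)
    rwa [intervalIntegrable_iff_integrableOn_Ioc_of_le zero_le_one] at h2
  have hfin : ∫⁻ s, ENNReal.ofReal (g s) ∂(volume.restrict (Ioc (0:ℝ) 1)) ≠ ⊤ :=
    (Integrable.lintegral_lt_top hgi).ne
  obtain ⟨η, hη, H⟩ := exists_pos_setLIntegral_lt_of_measure_lt hfin ha
  have hev : ∀ᶠ m in nhdsWithin (0:ℝ) (Ioi 0), ENNReal.ofReal m < η := by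
    have : Tendsto ENNReal.ofReal (nhds 0) (nhds 0) := by
      simpa using (ENNReal.continuous_ofReal.tendsto 0)
    exact (this.mono_left nhdsWithin_le_nhds).eventually (gt_mem_nhds hη)
  filter_upwards [hev, Ioo_mem_nhdsGT (zero_lt_one (α := ℝ))] with m hm hm1 μ L hb
  have hsub : Ioo 0 m ⊆ Ioc (0:ℝ) 1 := fun t ht => ⟨ht.1, (ht.2.trans hm1.2).le⟩
  have hres : (volume.restrict (Ioc (0:ℝ) 1)).restrict (Ioo 0 m) = volume.restrict (Ioo 0 m) := by
    rw [Measure.restrict_restrict measurableSet_Ioo, inter_eq_left.mpr hsub]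
  have hH := H (Ioo 0 m) (by
    rw [Measure.restrict_apply measurableSet_Ioo, inter_eq_left.mpr hsub]
    simpa using hm)
  rw [hres, ← setLInt_reflect] at hH
  refine lt_of_le_of_lt ?_ hH
  unfold runningCost
  rw [← setLIntegral_congr (Ioo_ae_eq_Ioc)]
  refine setLIntegral_mono' measurableSet_Ioo fun t ht => ENNReal.ofReal_le_ofReal ?_
  have := Finset.sum_le_card_nsmul M.E _ _ (hb t ht)
  simpa only [hg, nsmul_eq_mul] using this

lemma stay_cost {r : ℕ} (M : MeanFieldModel r) {μ : Fin r → ℝ} (hμ : μ ∈ stdSimplex ℝ (Fin r))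
    {p : Fin r × Fin r} (hp : p ∈ M.E) :
    μ p.1 * M.lam p.1 p.2 μ * tauStar (0 / M.lam p.1 p.2 μ - 1) ≤ M.Cb := by
  have h1 := M.lam_lower p hp μ hμ
  have h2 := M.lam_upper p hp μ hμ
  have h3 := hμ.1 p.1
  have h4 : μ p.1 ≤ 1 := (mem_Icc_of_mem_stdSimplex hμ p.1).2
  have hc := M.c_pos
  have : tauStar (0 / M.lam p.1 p.2 μ - 1) = 1 := by simp [tauStar]
  rw [this, mul_one]
  nlinarith

lemma move_cost {r : ℕ} (M : MeanFieldModel r) {μ : Fin r → ℝ} (hμ : μ ∈ stdSimplex ℝ (Fin r))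
    {p : Fin r × Fin r} (hp : p ∈ M.E) {s : ℝ} (hs : 0 < s) (hsp : s ≤ μ p.1) :
    μ p.1 * M.lam p.1 p.2 μ * tauStar ((μ p.1)⁻¹ / M.lam p.1 p.2 μ - 1) ≤
      M.Cb + |Real.log M.c| + |Real.log s| := by
  have h1 := M.lam_lower p hp μ hμ
  have h2 := M.lam_upper p hp μ hμ
  have h3 : 0 < μ p.1 := hs.trans_le hsp
  have h4 : μ p.1 ≤ 1 := (mem_Icc_of_mem_stdSimplex hμ p.1).2
  have hc := M.c_pos
  set l := M.lam p.1 p.2 μ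
  set a := μ p.1
  have hl : 0 < l := hc.trans_le h1
  have e : a * l * tauStar (a⁻¹ / l - 1) = -Real.log a - Real.log l - 1 + a * l := by
    unfold tauStar
    rw [sub_add_cancel, Real.log_div (inv_ne_zero h3.ne') hl.ne', Real.log_inv]
    field_simp
    ring
  rw [e]
  have k1 : Real.log s ≤ Real.log a := Real.log_le_log hs hsp
  have k2 : Real.log M.c ≤ Real.log l := Real.log_le_log hc h1
  have k3 := neg_abs_le (Real.log M.c)
  have k4 := neg_abs_le (Real.log s)
  have k5 : a * l ≤ M.Cb := by nlinarith
  linarith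

lemma reach_self {r : ℕ} (M : MeanFieldModel r) {a : ℝ≥0∞} (ha : a ≠ 0) {x : Fin r → ℝ}
    (hx : x ∈ stdSimplex ℝ (Fin r)) : Reach M x x a := by
  obtain ⟨m, hm, hm0⟩ := ((cost_small M ha).and self_mem_nhdsWithin).exists
  refine ⟨m, fun _ => x, fun _ _ _ => 0, hm0, ⟨⟨?_, ?_, ?_, ?_⟩, ⟨?_, ?_⟩, rfl, rfl, fun _ _ => hx⟩,
    hm _ _ fun t ht p hp => ?_⟩
  · intro i j; exact measurable_const
  · intros; exact le_rfl
  · intros; rfl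
  · intros; simp
  · intro i; simp
  · intros; simp
  · have := stay_cost M hx hp
    have h1 := abs_nonneg (Real.log M.c)
    have h2 := abs_nonneg (Real.log (m - t))
    linarith

lemma move_mem {r : ℕ} {x : Fin r → ℝ} (hx : x ∈ stdSimplex ℝ (Fin r)) (i j : Fin r) {t : ℝ}
    (ht : 0 ≤ t) (hti : t ≤ x i) :
    x + t • (Pi.single j 1 - Pi.single i 1 : Fin r → ℝ) ∈ stdSimplex ℝ (Fin r) := by
  constructor
  · intro k
    have := hx.1 k
    simp only [Pi.add_apply, Pi.smul_apply, Pi.sub_apply, smul_eq_mul, Pi.single_apply]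
    split_ifs with h1 h2 h2
    · linarith
    · linarith
    · subst h2; linarith
    · linarith
  · have := hx.2
    simp [Finset.sum_add_distrib, ← Finset.mul_sum, this]

lemma reach_edge {r : ℕ} (M : MeanFieldModel r) {a : ℝ≥0∞} (ha : a ≠ 0) {i j : Fin r}
    (hij : (i, j) ∈ M.E) :
    ∀ᶠ m in nhdsWithin (0:ℝ) (Ioi 0), ∀ x ∈ stdSimplex ℝ (Fin r), m ≤ x i →
      Reach M x (x + m • (Pi.single j 1 - Pi.single i 1 : Fin r → ℝ)) a := by
  have hne : i ≠ j := by rintro rfl; exact M.no_diag _ hij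
  filter_upwards [cost_small M ha, self_mem_nhdsWithin] with m hm hm0 x hx hmx
  have hm0 : 0 < m := hm0
  set d : Fin r → ℝ := Pi.single j 1 - Pi.single i 1 with hd
  set μ : ℝ → Fin r → ℝ := fun t => x + t • d with hμ
  set w : ℝ → ℝ := fun t => |x i - t|⁻¹ with hw
  set L : ℝ → Fin r → Fin r → ℝ := fun t p q => if p = i then w t * d q else 0 with hL
  have hdi : d i = -1 := by simp [hd, Pi.single_apply, hne]
  have hdj : d j = 1 := by simp [hd, Pi.single_apply, hne.symm]
  have hdk : ∀ k, k ≠ i → k ≠ j → d k = 0 := by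
    intro k h1 h2; simp [hd, Pi.single_apply, h1, h2]
  have hμi : ∀ t, μ t i = x i - t := by intro t; simp [hμ, hdi]; ring
  have hw0 : ∀ t, 0 ≤ w t := fun t => by positivity
  have hmem : ∀ t ∈ Icc 0 m, μ t ∈ stdSimplex ℝ (Fin r) := fun t ht =>
    move_mem hx i j ht.1 (ht.2.trans hmx)
  have hwt : ∀ t < m, w t = (μ t i)⁻¹ := by
    intro t ht
    rw [hμi, hw]
    simp only
    rw [abs_of_pos (by linarith)]
  have hvel : ∀ k, ∀ t < m, ∑ p, L t p k * μ t p = d k := by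
    intro k t ht
    have hpos : μ t i ≠ 0 := by rw [hμi]; linarith
    simp only [hL, ite_mul, zero_mul, Finset.sum_ite_eq', Finset.mem_univ, if_true]
    rw [hwt t ht]
    field_simp
  refine ⟨m, μ, L, hm0, ⟨⟨?_, ?_, ?_, ?_⟩, ⟨?_, ?_⟩, by simp [hμ], rfl, hmem⟩,
    hm _ _ fun t ht p hp => ?_⟩
  · intro p q
    simp only [hL]
    split_ifs
    · exact ((measurable_const.sub measurable_id).norm.inv).mul_const _
    · exact measurable_const
  · intro t p q hpq
    simp only [hL]
    split_ifs with h
    · subst h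
      by_cases hq : q = j
      · rw [hq, hdj, mul_one]; exact hw0 t
      · rw [hdk q hpq.symm hq, mul_zero]
    · exact le_rfl
  · intro t p q hpq hE
    simp only [hL]
    split_ifs with h
    · subst h
      rw [hdk q hpq.symm (by rintro rfl; exact hE hij), mul_zero]
    · rfl
  · intro t p
    simp only [hL]
    split_ifs with h
    · subst h
      rw [Finset.sum_eq_single j]
      · rw [hdi, hdj]; ring
      · intro b hb hbj
        rw [hdk b (by simpa using hb) hbj, mul_zero]
      · intro hb; simp [hne.symm] at hb
    · simp
  · intro k
    rw [integrableOn_Icc_iff_integrableOn_Ioo]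
    have : IntegrableOn (fun _ : ℝ => d k) (Ioo 0 m) := by
      apply integrableOn_const (by simp)
    exact this.congr_fun (fun t ht => (hvel k t ht.2).symm) measurableSet_Ioo
  · intro t ht k
    rw [integral_Ioc_eq_integral_Ioo, setIntegral_congr_fun measurableSet_Ioo
      (g := fun _ => d k) (fun s hs => hvel k s (hs.2.trans_le ht.2))]
    simp [hμ, ht.1]
  · have hmt := hmem t ⟨ht.1.le, ht.2.le⟩
    by_cases h : p = (i, j)
    · subst h
      have : L t i j = (μ t i)⁻¹ := by simp [hL, hdj, hwt t ht.2]
      simp only [this]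
      exact move_cost M hmt hij (by linarith [ht.2]) (by rw [hμi]; linarith)
    · have : L t p.1 p.2 = 0 := by
        simp only [hL]
        split_ifs with h1
        · rw [hdk p.2, mul_zero]
          · rintro h2
            exact M.no_diag i (by rwa [show p = (i, i) from Prod.ext h1 h2] at hp)
          · rintro h2
            exact h (Prod.ext h1 h2)
        · rfl
      rw [this]
      have := stay_cost M hmt hp
      have h1 := abs_nonneg (Real.log M.c)
      have h2 := abs_nonneg (Real.log (m - t))
      linarith

lemma reach_move {r : ℕ} (M : MeanFieldModel r) (i j : Fin r) : ∀ {a : ℝ≥0∞}, a ≠ 0 →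
    ∀ᶠ m in nhdsWithin (0:ℝ) (Ioi 0), ∀ x ∈ stdSimplex ℝ (Fin r), m ≤ x i →
      Reach M x (x + m • (Pi.single j 1 - Pi.single i 1 : Fin r → ℝ)) a := by
  induction M.irreducible i j with
  | refl =>
    intro a ha
    refine Eventually.of_forall fun m x hx _ => ?_
    simpa using reach_self M ha hx
  | @tail b c _ hbc ih =>
    intro a ha
    have ha2 : a / 2 ≠ 0 := (ENNReal.half_pos ha).ne'
    filter_upwards [ih ha2, reach_edge M ha2 hbc, self_mem_nhdsWithin] with m h1 h2 hm x hx hmx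
    have hm : 0 < m := hm
    have k1 := h1 x hx hmx
    have k2 := h2 _ k1.right_mem (by
      have := hx.1 b
      by_cases hbi : b = i
      · subst hbi; simpa using hmx
      · simp [Pi.single_apply, hbi, this])
    have k3 := k1.trans k2
    rw [ENNReal.add_halves] at k3
    convert k3 using 1
    module

lemma reach_near {r : ℕ} (M : MeanFieldModel r) (n : ℕ) : ∀ {a : ℝ≥0∞}, a ≠ 0 →
    ∃ η : ℝ, 0 < η ∧ ∀ x ∈ stdSimplex ℝ (Fin r), ∀ y ∈ stdSimplex ℝ (Fin r),
      (Finset.univ.filter fun k => x k ≠ y k).card ≤ n → dist x y < η → Reach M x y a := by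
  induction n with
  | zero =>
    intro a ha
    refine ⟨1, one_pos, fun x hx y hy hc _ => ?_⟩
    have : x = y := by
      funext k
      by_contra hk
      have : k ∈ (Finset.univ.filter fun k => x k ≠ y k) := by simpa using hk
      rw [Finset.card_eq_zero.mp (Nat.le_zero.mp hc)] at this
      simp at this
    subst this
    exact reach_self M ha hx
  | succ n ih =>
    intro a ha
    have ha2 : a / 2 ≠ 0 := (ENNReal.half_pos ha).ne'
    obtain ⟨η₁, hη₁, H₁⟩ := ih ha2
    have hev : ∀ᶠ m in nhdsWithin (0:ℝ) (Ioi 0), ∀ i j : Fin r, ∀ x ∈ stdSimplex ℝ (Fin r),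
        m ≤ x i → Reach M x (x + m • (Pi.single j 1 - Pi.single i 1 : Fin r → ℝ)) (a / 2) :=
      eventually_all.mpr fun i => eventually_all.mpr fun j => reach_move M i j ha2
    obtain ⟨η₂, hη₂, H₂⟩ := mem_nhdsGT_iff_exists_Ioo_subset.mp hev
    refine ⟨min η₁ η₂, lt_min hη₁ hη₂, fun x hx y hy hc hd => ?_⟩
    have hd1 := hd.trans_le (min_le_left _ _)
    have hd2 := hd.trans_le (min_le_right _ _)
    by_cases hxy : x = y
    · subst hxy; exact reach_self M ha hx
    have hsum : ∑ k, x k = ∑ k, y k := hx.2.trans hy.2.symm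
    obtain ⟨i, hi⟩ : ∃ i, y i < x i := by
      by_contra! hcon
      exact hxy (funext fun k => (Finset.sum_eq_sum_iff_of_le fun k _ => hcon k).mp hsum k
        (Finset.mem_univ k))
    obtain ⟨j, hj⟩ : ∃ j, x j < y j := by
      by_contra! hcon
      exact hxy (funext fun k => ((Finset.sum_eq_sum_iff_of_le fun k _ => hcon k).mp hsum.symm k
        (Finset.mem_univ k)).symm)
    have hij : i ≠ j := by rintro rfl; linarith
    set m := min (x i - y i) (y j - x j) with hm
    have hm0 : 0 < m := lt_min (by linarith) (by linarith)
    have hmi : m ≤ x i - y i := min_le_left _ _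
    have hmj : m ≤ y j - x j := min_le_right _ _
    have hdi := dist_le_pi_dist x y i
    have hdj := dist_le_pi_dist x y j
    rw [Real.dist_eq, abs_of_pos (by linarith)] at hdi
    rw [Real.dist_eq, abs_of_neg (by linarith)] at hdj
    have k1 := H₂ ⟨hm0, by linarith⟩ i j x hx (by linarith [hy.1 i])
    set z := x + m • (Pi.single j 1 - Pi.single i 1 : Fin r → ℝ) with hz
    have hzi : z i = x i - m := by simp [hz, Pi.single_apply, hij]; ring
    have hzj : z j = x j + m := by simp [hz, Pi.single_apply, hij.symm]
    have hzk : ∀ k, k ≠ i → k ≠ j → z k = x k := by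
      intro k h1 h2; simp [hz, Pi.single_apply, h1, h2]
    have k2 := H₁ z k1.right_mem y hy ?_ ?_
    · have k3 := k1.trans k2
      rwa [ENNReal.add_halves] at k3
    · rw [← Nat.lt_succ_iff]
      refine lt_of_lt_of_le (Finset.card_lt_card ?_) hc
      rw [Finset.ssubset_iff_of_subset]
      · rcases min_choice (x i - y i) (y j - x j) with h | h
        · refine ⟨i, by simpa using hi.ne', ?_⟩
          simp only [Finset.mem_filter, Finset.mem_univ, true_and, not_not]
          linarith
        · refine ⟨j, by simpa using hj.ne, ?_⟩
          simp only [Finset.mem_filter, Finset.mem_univ, true_and, not_not]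
          linarith
      · intro k
        simp only [Finset.mem_filter, Finset.mem_univ, true_and]
        intro hk
        by_cases h1 : k = i
        · subst h1; exact hi.ne'
        by_cases h2 : k = j
        · subst h2; exact hj.ne
        rwa [hzk k h1 h2] at hk
    · refine lt_of_le_of_lt ?_ hd1
      rw [dist_pi_le_iff dist_nonneg]
      intro k
      by_cases h1 : k = i
      · subst h1
        rw [hzi, Real.dist_eq, abs_of_nonneg (by linarith)]; linarith
      by_cases h2 : k = j
      · subst h2
        rw [hzj, Real.dist_eq, abs_of_nonpos (by linarith)]; linarith
      rw [hzk k h1 h2]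
      exact dist_le_pi_dist x y k

lemma reach_local {r : ℕ} (M : MeanFieldModel r) {a : ℝ≥0∞} (ha : a ≠ 0) :
    ∃ η : ℝ, 0 < η ∧ ∀ x ∈ stdSimplex ℝ (Fin r), ∀ y ∈ stdSimplex ℝ (Fin r),
      dist x y < η → Reach M x y a := by
  obtain ⟨η, hη, H⟩ := reach_near M r ha
  refine ⟨η, hη, fun x hx y hy => H x hx y hy ?_⟩
  simpa using Finset.card_le_univ (Finset.univ.filter fun k => x k ≠ y k)

end Helpers

/-- if all points of the compact set `K` are equivalent to each
other but to no point of `M₁(Z)` outside `K`, then for any `ε, δ > 0` and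
`ν, ξ ∈ K` there is a finite-time path from `ν` to `ξ` staying in the open
`δ`-neighborhood of `K` with cost `< ε`. -/
theorem stmt7 (r : ℕ) (hr : 0 < r) (M : MeanFieldModel r)
    (K : Set (Fin r → ℝ)) (hK : IsCompact K) (hKs : K ⊆ stdSimplex ℝ (Fin r))
    (hin : ∀ ν ∈ K, ∀ ξ ∈ K, VEquiv M ν ξ)
    (hout : ∀ ν ∈ K, ∀ ξ ∈ stdSimplex ℝ (Fin r), ξ ∉ K → ¬ VEquiv M ν ξ) :
    ∀ ε : ℝ, 0 < ε → ∀ δ : ℝ, 0 < δ → ∀ ν ∈ K, ∀ ξ ∈ K,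
      ∃ T : ℝ, 0 < T ∧ ∃ μ : ℝ → Fin r → ℝ, μ 0 = ν ∧ μ T = ξ ∧
        (∀ t ∈ Icc (0 : ℝ) T, ∃ y ∈ K, dist (μ t) y < δ) ∧
        SPath M T ν μ < ENNReal.ofReal ε := by
  intro ε hε δ hδ ν hν ξ hξ
  by_contra hcon
  have key : ∀ n : ℕ, ∃ x ∈ stdSimplex ℝ (Fin r), (∀ y ∈ K, δ ≤ dist x y) ∧
      Reach M ν x ((n : ℝ≥0∞) + 1)⁻¹ ∧ Reach M x ξ ((n : ℝ≥0∞) + 1)⁻¹ := by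
    intro n
    have hb : ((n : ℝ≥0∞) + 1)⁻¹ ≠ 0 := by
      rw [Ne, ENNReal.inv_eq_zero]
      exact ENNReal.add_ne_top.mpr ⟨ENNReal.natCast_ne_top n, ENNReal.one_ne_top⟩
    have ha : min (ENNReal.ofReal ε) ((n : ℝ≥0∞) + 1)⁻¹ ≠ 0 :=
      (lt_min (ENNReal.ofReal_pos.mpr hε) (pos_iff_ne_zero.mpr hb)).ne'
    obtain ⟨T, μ, L, hT, hC, hc⟩ := (quasi_zero_iff M ν ξ).mp (hin ν hν ξ hξ).1 _ ha
    have hfar : ∃ t ∈ Icc (0 : ℝ) T, ∀ y ∈ K, δ ≤ dist (μ t) y := by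
      by_contra! hno
      refine hcon ⟨T, hT, μ, hC.2.2.1, hC.2.2.2.1, hno, ?_⟩
      refine lt_of_le_of_lt ?_ (hc.trans_le (min_le_left _ _))
      exact iInf₂_le L ⟨hC.1, hC.2.1, hC.2.2.1, hC.2.2.2.2⟩
    obtain ⟨t, ht, hfar⟩ := hfar
    have ht0 : 0 < t := by
      rcases ht.1.eq_or_lt with h | h
      · have := hfar ν hν
        rw [← h, hC.2.2.1, dist_self] at this
        linarith
      · exact h
    have htT : t < T := by
      rcases ht.2.eq_or_lt with h | h
      · have := hfar ξ hξ
        rw [h, hC.2.2.2.1, dist_self] at this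
        linarith
      · exact h
    have hc' := hc.trans_le (min_le_right _ _)
    rw [cost_split M μ L ht0.le htT.le] at hc'
    exact ⟨μ t, hC.2.2.2.2 t ht, hfar,
      ⟨t, μ, L, ht0, hC.restrict ht, le_self_add.trans_lt hc'⟩,
      ⟨T - t, _, _, by linarith, hC.shift ht, le_add_self.trans_lt hc'⟩⟩
  choose u hu hfar hr1 hr2 using key
  obtain ⟨x, hx, φ, hφ, hlim⟩ := (isCompact_stdSimplex ℝ (Fin r)).tendsto_subseq hu
  have hxK : x ∉ K := by
    intro hxK
    have := ge_of_tendsto (hlim.dist (tendsto_const_nhds (x := x)))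
      (Eventually.of_forall fun n => hfar (φ n) x hxK)
    rw [dist_self] at this
    linarith
  have hsmall : ∀ b : ℝ≥0∞, b ≠ 0 → ∀ η : ℝ, 0 < η →
      ∃ n : ℕ, ((n : ℝ≥0∞) + 1)⁻¹ ≤ b ∧ dist (u n) x < η := by
    intro b hb η hη
    obtain ⟨N, hN⟩ := ENNReal.exists_inv_nat_lt hb
    have e1 : ∀ᶠ n in atTop, dist (u (φ n)) x < η :=
      (Metric.tendsto_nhds.mp hlim η hη)
    obtain ⟨n, hn1, hn2⟩ := (e1.and (eventually_ge_atTop N)).exists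
    refine ⟨φ n, le_trans ?_ hN.le, hn1⟩
    rw [ENNReal.inv_le_inv]
    have : N ≤ φ n := hn2.trans (hφ.id_le n)
    calc (N : ℝ≥0∞) ≤ (φ n : ℝ≥0∞) := by exact_mod_cast this
      _ ≤ _ := le_self_add
  refine hout ν hν x hx hxK ⟨?_, ?_⟩
  · rw [quasi_zero_iff]
    intro a ha
    have ha2 : a / 2 ≠ 0 := (ENNReal.half_pos ha).ne'
    obtain ⟨η, hη, H⟩ := reach_local M ha2
    obtain ⟨n, hn1, hn2⟩ := hsmall _ ha2 η hη
    have k := ((hr1 n).mono hn1).trans (H _ (hu n) _ hx hn2)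
    rwa [ENNReal.add_halves] at k
  · rw [quasi_zero_iff]
    intro a ha
    have ha2 : a / 2 ≠ 0 := (ENNReal.half_pos ha).ne'
    have ha4 : a / 2 / 2 ≠ 0 := (ENNReal.half_pos ha2).ne'
    obtain ⟨η, hη, H⟩ := reach_local M ha4
    obtain ⟨n, hn1, hn2⟩ := hsmall _ ha4 η hη
    have k := (H _ hx _ (hu n) (by rwa [dist_comm])).trans ((hr2 n).mono hn1)
    rw [ENNReal.add_halves] at k
    have k2 := k.trans ((quasi_zero_iff M ξ ν).mp (hin ν hν ξ hξ).2 _ ha2)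
    rwa [ENNReal.add_halves] at k2
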